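/- Let R be a point of PG(2,q²) not on ℓ∞ and let ℓ be the line through P∞ and R (so ℓ ≠ ℓ∞). Then for every point P ∉ U whose pedal τ_P(U) is not contained in ℓ, the set ℓ ∩ τ_P(U) contains at most one point (that is, ℓ is tangent or exterior to every pedal not contained in ℓ). -/

import Mathlib

noncomputable section
open Projectivization
open scoped LinearAlgebra.Projectivization

/-- `Pt K` is the point set of `PG(2, q²)`, i.e. the projectivization of `K³`. -/
abbrev Pt (K : Type) [Field K] : Type := ℙ K (Fin 3 → K)

lemma vec1_ne_zero {K : Type} [Field K] (a b : K) : ![a, b, (1 : K)] ≠ 0 := by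
  intro h
  have := congrFun h 2
  simp at this

lemma vecInf_ne_zero {K : Type} [Field K] : ![(0 : K), 1, 0] ≠ 0 := by
  intro h
  have := congrFun h 1
  simp at this

lemma vec100_ne_zero {K : Type} [Field K] : ![(1 : K), 0, 0] ≠ 0 := by
  intro h
  have := congrFun h 0
  simp at this

/-- The orthogonal-Buekenhout-Metz unital
`U = {[x, αx² + βN(x) + r, 1] : x ∈ K, r ∈ GF(q)} ∪ {[0,1,0]}`,
where `GF(q) = {r : r^q = r}` and `N(x) = x^(q+1)`. -/
def unital (K : Type) [Field K] (q : ℕ) (α β : K) : Set (Pt K) :=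
  {P | (∃ x r : K, r ^ q = r ∧
      P = Projectivization.mk K ![x, α * x ^ 2 + β * x ^ (q + 1) + r, 1] (vec1_ne_zero _ _)) ∨
    P = Projectivization.mk K ![0, 1, 0] vecInf_ne_zero}

/-- The line through two points `A`, `B`: all points `[w]` with `w ∈ span{u, v}` where
`A = [u]`, `B = [v]`. -/
def lineThrough {K : Type} [Field K] (A B : Pt K) : Set (Pt K) :=
  {C | C.submodule ≤ A.submodule ⊔ B.submodule}

/-- The pedal `τ_P(U)` of `P`: the set of feet of `P`, i.e. points `A ∈ U` such that `A`
is the only point of `U` on the line through `P` and `A`. -/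
def pedal {K : Type} [Field K] (U : Set (Pt K)) (P : Pt K) : Set (Pt K) :=
  {A | A ∈ U ∧ lineThrough P A ∩ U = {A}}

/-- The line at infinity `ℓ∞ = {[a, b, 0]}`. -/
def linf (K : Type) [Field K] : Set (Pt K) := {P | P.rep 2 = 0}

section Conjugation

variable {K : Type} [Field K]

/-- In a field with `q²` elements, `x ↦ x ^ q` is an involutive ring homomorphism. -/
lemma exists_conj [Fintype K] {p n q : ℕ} (hp : p.Prime) (hn : 0 < n) (hq : q = p ^ n)
    (hcard : Fintype.card K = q ^ 2) :
    ∃ σ : K →+* K, (∀ x, σ x = x ^ q) ∧ ∀ x, σ (σ x) = x := by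
  obtain ⟨p', hchar⟩ := CharP.exists K
  obtain ⟨k, hp', hk⟩ := FiniteField.card K p'
  have hdvd : p ∣ p' ^ (k : ℕ) := by
    rw [← hk, hcard, hq]
    exact dvd_pow (dvd_pow_self p hn.ne') two_ne_zero
  obtain rfl : p = p' := (Nat.prime_dvd_prime_iff_eq hp hp').mp (hp.dvd_of_dvd_pow hdvd)
  have : ExpChar K p := ExpChar.prime hp
  have hσ : ∀ x : K, iterateFrobenius K p n x = x ^ q := fun x => by
    rw [iterateFrobenius_def, hq]
  refine ⟨iterateFrobenius K p n, hσ, fun x => ?_⟩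
  rw [hσ, hσ, ← pow_mul, ← sq, ← hcard, FiniteField.pow_card]

variable {σ : K →+* K} {α β : K}

lemma exists_conj_ne (hns : ¬ ∃ s, σ s = s ∧ 4 * (α * σ α) + (σ β - β) ^ 2 = s ^ 2) :
    ∃ e, σ e ≠ e := by
  by_contra! h
  exact hns ⟨2 * α, h _, by rw [h, h]; ring⟩

/-- The form `t ↦ αt² - ᾱt̄² + (β - β̄)tt̄` is anisotropic. -/
lemma conj_form_anisotropic (hσ : ∀ x, σ (σ x) = x)
    (hns : ¬ ∃ s, σ s = s ∧ 4 * (α * σ α) + (σ β - β) ^ 2 = s ^ 2) {t : K} (ht : t ≠ 0) :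
    α * t ^ 2 - σ α * σ t ^ 2 + (β - σ β) * (t * σ t) ≠ 0 := by
  intro h
  have ht' : σ t ≠ 0 := (map_ne_zero σ).mpr ht
  refine hns ⟨2 * α * (t / σ t) + (β - σ β), ?_, ?_⟩
  · simp only [map_add, map_sub, map_mul, map_div₀, hσ, map_ofNat]
    field_simp
    linear_combination -2 * h
  · field_simp
    linear_combination -4 * α * h

/-- The slope of the tangent line to the unital at its points with abscissa `x`. -/
def tangentSlope (σ : K →+* K) (α β x : K) : K := 2 * α * x + (β - σ β) * σ x

lemma tangentSlope_injective (hσ : ∀ x, σ (σ x) = x)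
    (hns : ¬ ∃ s, σ s = s ∧ 4 * (α * σ α) + (σ β - β) ^ 2 = s ^ 2) :
    Function.Injective (tangentSlope σ α β) := by
  intro x y hxy
  by_contra hne
  have hd : x - y ≠ 0 := sub_ne_zero.mpr hne
  have hd' : σ x - σ y ≠ 0 := by rw [← map_sub]; exact (map_ne_zero σ).mpr hd
  unfold tangentSlope at hxy
  have hxy' := congrArg σ hxy
  simp only [map_add, map_sub, map_mul, hσ, map_ofNat] at hxy'
  refine hns ⟨0, map_zero σ, mul_left_cancel₀ (mul_ne_zero hd hd') ?_⟩
  linear_combination (2 * σ α * (σ x - σ y)) * hxy - (β - σ β) * (σ x - σ y) * hxy'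

/-- A line whose slope is not the tangent slope meets the unital a second time. -/
lemma exists_ne_zero_secant (hσ : ∀ x, σ (σ x) = x)
    (hns : ¬ ∃ s, σ s = s ∧ 4 * (α * σ α) + (σ β - β) ^ 2 = s ^ 2)
    {x m : K} (hm : m ≠ tangentSlope σ α β x) :
    ∃ t ≠ 0, σ (m * t + α * x ^ 2 + β * (σ x * x)
        - α * (x + t) ^ 2 - β * (σ (x + t) * (x + t))) =
      m * t + α * x ^ 2 + β * (σ x * x)
        - α * (x + t) ^ 2 - β * (σ (x + t) * (x + t)) := by
  obtain ⟨e, he⟩ := exists_conj_ne hns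
  obtain ⟨c, hc⟩ : ∃ c, c = tangentSlope σ α β x - m := ⟨_, rfl⟩
  have hc0 : c ≠ 0 := by rw [hc]; exact sub_ne_zero.mpr hm.symm
  have he0 : e ≠ 0 := by rintro rfl; exact he (map_zero σ)
  obtain ⟨t, ht⟩ : ∃ t, t = e / c := ⟨_, rfl⟩
  have hct : c * t = e := by rw [ht]; field_simp
  have ht0 : t ≠ 0 := by rw [ht]; exact div_ne_zero he0 hc0
  have hQ := conj_form_anisotropic hσ hns ht0
  obtain ⟨Q, hQdef⟩ :
      ∃ Q, Q = α * t ^ 2 - σ α * σ t ^ 2 + (β - σ β) * (t * σ t) := ⟨_, rfl⟩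
  rw [← hQdef] at hQ
  have hσQ : σ Q = -Q := by
    rw [hQdef]
    simp only [map_add, map_sub, map_mul, map_pow, hσ]
    ring
  obtain ⟨r, hr⟩ : ∃ r, r = (σ e - e) / Q := ⟨_, rfl⟩
  have hrQ : r * Q = σ e - e := by rw [hr]; field_simp
  have hr0 : r ≠ 0 := by rw [hr]; exact div_ne_zero (sub_ne_zero.mpr he) hQ
  have hσr : σ r = r := by
    rw [hr, map_div₀, map_sub, hσ, hσQ]
    field_simp
    ring
  have hσe : σ c * σ t = σ e := by rw [← map_mul, hct]
  have hσc : σ c = 2 * σ α * σ x + (σ β - β) * x - σ m := by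
    rw [hc, tangentSlope]
    simp only [map_add, map_sub, map_mul, hσ, map_ofNat]
  refine ⟨r * t, mul_ne_zero hr0 ht0, ?_⟩
  simp only [map_add, map_sub, map_mul, map_pow, hσ, hσr]
  rw [hσc] at hσe
  rw [hc, tangentSlope] at hct
  rw [hQdef] at hrQ
  linear_combination r * hrQ + r * hct - r * hσe

end Conjugation

section Points

variable {K : Type} [Field K]

/-- The affine point `[x, y, 1]`. -/
abbrev affinePt (x y : K) : Pt K := Projectivization.mk K ![x, y, 1] (vec1_ne_zero x y)

/-- The point `P∞ = [0, 1, 0]`. -/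
abbrev infPt (K : Type) [Field K] : Pt K := Projectivization.mk K ![0, 1, 0] vecInf_ne_zero

lemma vecSlope_ne_zero (m : K) : ![(1 : K), m, 0] ≠ 0 := by
  intro h
  have := congrFun h 0
  simp at this

/-- The point at infinity `[1, m, 0]` of the lines of slope `m`. -/
abbrev slopePt (m : K) : Pt K := Projectivization.mk K ![1, m, 0] (vecSlope_ne_zero m)

lemma pt_cases (P : Pt K) :
    (∃ x y, P = affinePt x y) ∨ (∃ m, P = slopePt m) ∨ P = infPt K := by
  induction P using Projectivization.ind with
  | h v hv =>
    by_cases h2 : v 2 = 0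
    · by_cases h0 : v 0 = 0
      · refine Or.inr (Or.inr ((Projectivization.mk_eq_mk_iff' ..).mpr ⟨v 1, ?_⟩))
        ext i; fin_cases i <;> simp [h0, h2]
      · refine Or.inr (Or.inl ⟨v 1 / v 0, (Projectivization.mk_eq_mk_iff' ..).mpr ⟨v 0, ?_⟩⟩)
        ext i; fin_cases i <;> simp [h2, mul_div_cancel₀, h0]
    · refine Or.inl ⟨v 0 / v 2, v 1 / v 2, (Projectivization.mk_eq_mk_iff' ..).mpr ⟨v 2, ?_⟩⟩
      ext i; fin_cases i <;> simp [mul_div_cancel₀, h2]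

lemma affinePt_inj {x y x' y' : K} : affinePt x y = affinePt x' y' ↔ x = x' ∧ y = y' := by
  refine ⟨fun h => ?_, by rintro ⟨rfl, rfl⟩; rfl⟩
  obtain ⟨a, ha⟩ := (Projectivization.mk_eq_mk_iff' ..).mp h
  have h0 := congrFun ha 0
  have h1 := congrFun ha 1
  have h2 := congrFun ha 2
  simp at h0 h1 h2
  subst h2
  simp at h0 h1
  exact ⟨h0.symm, h1.symm⟩

lemma affinePt_ne_infPt (x y : K) : affinePt x y ≠ infPt K := by
  intro h
  obtain ⟨a, ha⟩ := (Projectivization.mk_eq_mk_iff' ..).mp h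
  simpa using congrFun ha 2

lemma mk_mem_linf {v : Fin 3 → K} (hv : v ≠ 0) (h : v 2 = 0) :
    Projectivization.mk K v hv ∈ linf K := by
  obtain ⟨a, ha⟩ := Projectivization.exists_smul_eq_mk_rep K v hv
  have h2 := congrFun ha 2
  simp only [Pi.smul_apply, h, smul_zero] at h2
  exact h2.symm

lemma mk_mem_lineThrough {u v w : Fin 3 → K} (hu : u ≠ 0) (hv : v ≠ 0) (hw : w ≠ 0) :
    Projectivization.mk K w hw ∈
        lineThrough (Projectivization.mk K u hu) (Projectivization.mk K v hv) ↔
      ∃ a b : K, a • u + b • v = w := by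
  simp only [lineThrough, Set.mem_ofPred_eq, Projectivization.submodule_mk]
  rw [Submodule.span_singleton_le_iff_mem, ← Submodule.span_insert, Submodule.mem_span_pair]

lemma affinePt_mem_vertical {x y a b : K} :
    affinePt x y ∈ lineThrough (infPt K) (affinePt a b) ↔ x = a := by
  rw [mk_mem_lineThrough]
  constructor
  · rintro ⟨s, t, h⟩
    have h0 := congrFun h 0
    have h2 := congrFun h 2
    simp at h0 h2
    simpa [h2] using h0.symm
  · rintro rfl
    exact ⟨y - b, 1, by ext i; fin_cases i <;> simp⟩

lemma infPt_mem_vertical (P : Pt K) : infPt K ∈ lineThrough (infPt K) P := by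
  simp only [lineThrough, Set.mem_ofPred_eq]
  exact le_sup_left

lemma infPt_mem_lineThrough {x y b : K} (h : b ≠ y) :
    infPt K ∈ lineThrough (affinePt x b) (affinePt x y) := by
  rw [mk_mem_lineThrough]
  have h' : b - y ≠ 0 := sub_ne_zero.mpr h
  refine ⟨(b - y)⁻¹, -(b - y)⁻¹, ?_⟩
  ext i; fin_cases i <;> simp
  field_simp
  ring

lemma affinePt_mem_lineThrough_slopePt (m x y t : K) :
    affinePt (x + t) (y + m * t) ∈ lineThrough (slopePt m) (affinePt x y) := by
  rw [mk_mem_lineThrough]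
  refine ⟨t, 1, ?_⟩
  ext i; fin_cases i <;> simp <;> ring

lemma affinePt_mem_lineThrough_affinePt {a b x y : K} (h : x ≠ a) (t : K) :
    affinePt (x + t) (y + (y - b) / (x - a) * t) ∈
      lineThrough (affinePt a b) (affinePt x y) := by
  rw [mk_mem_lineThrough]
  have h' : x - a ≠ 0 := sub_ne_zero.mpr h
  refine ⟨-t / (x - a), 1 + t / (x - a), ?_⟩
  ext i; fin_cases i <;> simp <;> field_simp <;> ring

end Points

section Unital

variable {K : Type} [Field K] {q : ℕ} {α β : K}

lemma infPt_mem_unital : infPt K ∈ unital K q α β := Or.inr rfl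

lemma affinePt_mem_unital {x y : K} :
    affinePt x y ∈ unital K q α β ↔
      (y - α * x ^ 2 - β * x ^ (q + 1)) ^ q = y - α * x ^ 2 - β * x ^ (q + 1) := by
  constructor
  · rintro (⟨x', r, hr, h⟩ | h)
    · obtain ⟨rfl, rfl⟩ := affinePt_inj.mp h
      rwa [show α * x ^ 2 + β * x ^ (q + 1) + r - α * x ^ 2 - β * x ^ (q + 1) = r by ring]
    · exact (affinePt_ne_infPt _ _ h).elim
  · exact fun h => Or.inl ⟨x, _, h, affinePt_inj.mpr ⟨rfl, by ring⟩⟩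

variable {σ : K →+* K}

lemma eq_tangentSlope_of_tangent (hσq : ∀ x, σ x = x ^ q) (hσ : ∀ x, σ (σ x) = x)
    (hns : ¬ ∃ s, σ s = s ∧ 4 * (α * σ α) + (σ β - β) ^ 2 = s ^ 2) {x y m : K} {P : Pt K}
    (hfoot : affinePt x y ∈ pedal (unital K q α β) P)
    (hline : ∀ t, affinePt (x + t) (y + m * t) ∈ lineThrough P (affinePt x y)) :
    m = tangentSlope σ α β x := by
  by_contra hm
  obtain ⟨t, ht, h⟩ := exists_ne_zero_secant hσ hns hm
  have hA := affinePt_mem_unital.mp hfoot.1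
  simp only [pow_succ x q, ← hσq] at hA
  have hB : affinePt (x + t) (y + m * t) ∈ unital K q α β := by
    rw [affinePt_mem_unital, pow_succ (x + t) q, ← hσq, ← hσq]
    have hsum := congrArg₂ (· + ·) hA h
    simp only [← map_add σ (y - _ - _)] at hsum
    convert hsum using 2 <;> ring
  have hmem : affinePt (x + t) (y + m * t) ∈ ({affinePt x y} : Set (Pt K)) :=
    hfoot.2 ▸ ⟨hline t, hB⟩
  exact ht (by simpa using (affinePt_inj.mp hmem).1)

lemma slope_eq_of_foot (hσq : ∀ x, σ x = x ^ q) (hσ : ∀ x, σ (σ x) = x)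
    (hns : ¬ ∃ s, σ s = s ∧ 4 * (α * σ α) + (σ β - β) ^ 2 = s ^ 2) {x y m : K}
    (hfoot : affinePt x y ∈ pedal (unital K q α β) (slopePt m)) :
    m = tangentSlope σ α β x :=
  eq_tangentSlope_of_tangent hσq hσ hns hfoot (affinePt_mem_lineThrough_slopePt m x y)

lemma ordinate_eq_of_foot (hσq : ∀ x, σ x = x ^ q) (hσ : ∀ x, σ (σ x) = x)
    (hns : ¬ ∃ s, σ s = s ∧ 4 * (α * σ α) + (σ β - β) ^ 2 = s ^ 2) {a b x y : K}
    (hP : affinePt a b ∉ unital K q α β)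
    (hfoot : affinePt x y ∈ pedal (unital K q α β) (affinePt a b)) :
    y = b + tangentSlope σ α β x * (x - a) := by
  have hxa : x ≠ a := by
    rintro rfl
    have hby : b ≠ y := by rintro rfl; exact hP hfoot.1
    have hmem : infPt K ∈ ({affinePt x y} : Set (Pt K)) :=
      hfoot.2 ▸ ⟨infPt_mem_lineThrough hby, infPt_mem_unital⟩
    exact affinePt_ne_infPt x y (Eq.symm hmem)
  have h := eq_tangentSlope_of_tangent hσq hσ hns hfoot (affinePt_mem_lineThrough_affinePt hxa)
  have h' : x - a ≠ 0 := sub_ne_zero.mpr hxa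
  rw [← h]
  field_simp
  ring

lemma infPt_notMem_pedal_affinePt (hq : q ≠ 0) (a b : K) :
    infPt K ∉ pedal (unital K q α β) (affinePt a b) := by
  rintro ⟨-, h⟩
  have hmem : affinePt a (α * a ^ 2 + β * a ^ (q + 1)) ∈ ({infPt K} : Set (Pt K)) := by
    rw [← h]
    refine ⟨?_, Or.inl ⟨a, 0, zero_pow hq, affinePt_inj.mpr ⟨rfl, by ring⟩⟩⟩
    rw [lineThrough, sup_comm]
    exact affinePt_mem_vertical.mpr rfl
  exact affinePt_ne_infPt _ _ hmem

end Unital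

theorem stmt_3 {K : Type} [Field K] [Fintype K] (p n q : ℕ)
    (hp : p.Prime) (hpodd : Odd p) (hn : 0 < n) (hq : q = p ^ n)
    (hcard : Fintype.card K = q ^ 2)
    (α β : K) (hα : α ≠ 0)
    (hns : ¬ ∃ s : K, s ^ q = s ∧ 4 * α ^ (q + 1) + (β ^ q - β) ^ 2 = s ^ 2)
    (R : Pt K) (hR : R ∉ linf K)
    (P : Pt K) (hP : P ∉ unital K q α β)
    (hnc : ¬ pedal (unital K q α β) P ⊆
        lineThrough (Projectivization.mk K ![0, 1, 0] vecInf_ne_zero) R) :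
    (lineThrough (Projectivization.mk K ![0, 1, 0] vecInf_ne_zero) R ∩
        pedal (unital K q α β) P).Subsingleton := by
  obtain ⟨σ, hσq, hσ⟩ := exists_conj hp hn hq hcard
  have hq0 : q ≠ 0 := hq ▸ pow_ne_zero n hp.ne_zero
  have hns' : ¬ ∃ s, σ s = s ∧ 4 * (α * σ α) + (σ β - β) ^ 2 = s ^ 2 := by
    simpa only [hσq, ← pow_succ'] using hns
  obtain ⟨x₀, y₀, rfl⟩ : ∃ x y, R = affinePt x y := by
    rcases pt_cases R with h | ⟨m, rfl⟩ | rfl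
    · exact h
    · exact (hR (mk_mem_linf _ (by simp))).elim
    · exact (hR (mk_mem_linf _ (by simp))).elim
  have hcases : ∀ A ∈ unital K q α β, (∃ x y, A = affinePt x y) ∨ A = infPt K := by
    rintro A (⟨x, r, -, rfl⟩ | rfl)
    · exact Or.inl ⟨_, _, rfl⟩
    · exact Or.inr rfl
  rcases pt_cases P with ⟨a, b, rfl⟩ | ⟨m, rfl⟩ | rfl
  · have hfeet : ∀ A ∈ lineThrough (infPt K) (affinePt x₀ y₀) ∩
        pedal (unital K q α β) (affinePt a b),
        A = affinePt x₀ (b + tangentSlope σ α β x₀ * (x₀ - a)) := by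
      rintro A ⟨hA, hfoot⟩
      rcases hcases A hfoot.1 with ⟨x, y, rfl⟩ | rfl
      · obtain rfl := affinePt_mem_vertical.mp hA
        exact affinePt_inj.mpr ⟨rfl, ordinate_eq_of_foot hσq hσ hns' hP hfoot⟩
      · exact (infPt_notMem_pedal_affinePt hq0 a b hfoot).elim
    exact fun A hA B hB => (hfeet A hA).trans (hfeet B hB).symm
  · obtain ⟨B, hB, hBl⟩ := Set.not_subset.mp hnc
    have hfeet : ∀ A ∈ lineThrough (infPt K) (affinePt x₀ y₀) ∩
        pedal (unital K q α β) (slopePt m), A = infPt K := by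
      rintro A ⟨hA, hfoot⟩
      rcases hcases A hfoot.1 with ⟨x, y, rfl⟩ | rfl
      · obtain rfl := affinePt_mem_vertical.mp hA
        rcases hcases B hB.1 with ⟨x₁, y₁, rfl⟩ | rfl
        · refine (hBl (affinePt_mem_vertical.mpr (tangentSlope_injective hσ hns' ?_))).elim
          exact (slope_eq_of_foot hσq hσ hns' hB).symm.trans
            (slope_eq_of_foot hσq hσ hns' hfoot)
        · exact (hBl (infPt_mem_vertical _)).elim
      · rfl
    exact fun A hA B hB => (hfeet A hA).trans (hfeet B hB).symm
  · exact (hP infPt_mem_unital).elim
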